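/- Let q be an odd prime power with q ≡ 1 (mod 8) or q ≡ 7 (mod 8), let G = PSL(2, F_q), and let k be the 2-adic valuation of |G|. Then every cyclic subgroup of G of order 2^a with a ≥ 2 is pronormal in G, and every subgroup of G isomorphic to the dihedral group of order 2^{k−1} or to the dihedral group of order 2^k is pronormal in G. -/

import Mathlib

/-- The conjugate `H^g := g⁻¹ H g` of a subgroup `H` by an element `g`. -/
def Subgroup.conjugate {G : Type*} [Group G] (H : Subgroup G) (g : G) : Subgroup G :=
  H.map (MulAut.conj g⁻¹).toMonoidHom

/-- A subgroup `H` of a group `G` is pronormal in `G` if for every `g ∈ G` there exists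
`x ∈ ⟨H, H^g⟩` such that `H^x = H^g`. -/
def IsPronormal {G : Type*} [Group G] (H : Subgroup G) : Prop :=
  ∀ g : G, ∃ x ∈ (H ⊔ H.conjugate g : Subgroup G), H.conjugate x = H.conjugate g

open Matrix MatrixGroups

lemma psl_mem_center {F : Type*} [Field F] (A : SL(2, F)) :
    A ∈ Subgroup.center SL(2, F) ↔ A = 1 ∨ A = -1 := by
  rw [Matrix.SpecialLinearGroup.mem_center_iff]
  constructor
  · rintro ⟨r, hr, hA⟩
    simp only [Fintype.card_fin] at hr
    rcases mul_self_eq_one_iff.mp (by rw [← sq]; exact hr : r * r = 1) with h | h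
    · left; ext i j; rw [← hA]; fin_cases i <;> fin_cases j <;> simp [h]
    · right; ext i j; rw [← hA]; fin_cases i <;> fin_cases j <;> simp [h]
  · rintro (h | h)
    · exact ⟨1, by simp, by simp [h]⟩
    · exact ⟨-1, by simp, by simp [h, ← Matrix.diagonal_one, Matrix.diagonal_neg]⟩

lemma psl_mk_eq {F : Type*} [Field F] (A B : SL(2, F)) :
    (QuotientGroup.mk A : PSL(2, F)) = QuotientGroup.mk B ↔ B = A ∨ B = -A := by
  rw [QuotientGroup.eq, psl_mem_center, inv_mul_eq_iff_eq_mul, inv_mul_eq_iff_eq_mul]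
  simp

lemma psl_mk_eq_one {F : Type*} [Field F] (A : SL(2, F)) :
    (QuotientGroup.mk A : PSL(2, F)) = 1 ↔ A = 1 ∨ A = -1 := by
  rw [QuotientGroup.eq_one_iff, psl_mem_center]

lemma sl_sq_one {F : Type*} [Field F] (h2 : (2 : F) ≠ 0) (A : SL(2, F)) (h : A * A = 1) :
    A = 1 ∨ A = -1 := by
  have e : A⁻¹ = A := inv_eq_of_mul_eq_one_left h
  rw [Matrix.SpecialLinearGroup.ext_iff] at e
  simp [Matrix.SpecialLinearGroup.coe_inv, Matrix.adjugate_fin_two, Fin.forall_fin_two] at e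
  have d := A.det_coe
  rw [Matrix.det_fin_two] at d
  have h01 : A 0 1 = 0 := by
    have : 2 * A 0 1 = 0 := by linear_combination -e.1.2
    simpa [h2] using this
  have h10 : A 1 0 = 0 := by
    have : 2 * A 1 0 = 0 := by linear_combination -e.2.1
    simpa [h2] using this
  have h00 : A 0 0 * A 0 0 = 1 := by rw [h01, e.1.1] at d; linear_combination d
  rcases mul_self_eq_one_iff.mp h00 with h | h
  · left
    ext i j; fin_cases i <;> fin_cases j <;> simp [h01, h10, h, e.1.1]
  · right
    ext i j; fin_cases i <;> fin_cases j <;> simp [h01, h10, h, e.1.1]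

/-- trace zero iff square is -1 -/
lemma sl_sq_neg_one {F : Type*} [Field F] (A : SL(2, F)) (h : A * A = -1) :
    A 1 1 = - A 0 0 := by
  have e : A⁻¹ = -A := inv_eq_of_mul_eq_one_left (by rw [neg_mul, h, neg_neg])
  rw [Matrix.SpecialLinearGroup.ext_iff] at e
  have := e 0 0
  simpa [Matrix.SpecialLinearGroup.coe_inv, Matrix.adjugate_fin_two] using this

lemma sl_sq_of_trace {F : Type*} [Field F] (A : SL(2, F)) (h : A 1 1 = - A 0 0) :
    A * A = -1 := by
  have e : A⁻¹ = -A := by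
    ext i j
    fin_cases i <;> fin_cases j <;> simp [Matrix.SpecialLinearGroup.coe_inv, Matrix.adjugate_fin_two, h]
  rw [← neg_inj, ← neg_mul, ← e]; simp

lemma sl_entries {F : Type*} [Field F] (A B : SL(2, F)) : A = B ↔
    A 0 0 = B 0 0 ∧ A 0 1 = B 0 1 ∧ A 1 0 = B 1 0 ∧ A 1 1 = B 1 1 := by
  rw [Matrix.SpecialLinearGroup.ext_iff]; simp [Fin.forall_fin_two, and_assoc]

lemma sl_decomp {F : Type*} [Field F] (h2 : (2 : F) ≠ 0) (Z A : SL(2, F))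
    (hZ : Z * Z = -1) (hA : A * Z = Z * A) : ∃ α β : F,
      A 0 0 = α + β * Z 0 0 ∧ A 0 1 = β * Z 0 1 ∧ A 1 0 = β * Z 1 0 ∧
      A 1 1 = α - β * Z 0 0 := by
  have htr := sl_sq_neg_one Z hZ
  have hd := Z.det_coe
  rw [Matrix.det_fin_two, htr] at hd
  rw [sl_entries] at hA
  simp only [Matrix.SpecialLinearGroup.coe_mul, Matrix.mul_apply, Fin.sum_univ_two, htr] at hA
  obtain ⟨e1, e2, e3, e4⟩ := hA
  obtain ⟨h, hh⟩ : ∃ h : F, 2 * h = 1 := ⟨2⁻¹, mul_inv_cancel₀ h2⟩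
  refine ⟨h * (A 0 0 + A 1 1),
    -h * (A 0 0 * Z 0 0 + A 0 1 * Z 1 0 + A 1 0 * Z 0 1 - A 1 1 * Z 0 0), ?_, ?_, ?_, ?_⟩
  all_goals
    generalize A 0 0 = x at *
    generalize A 0 1 = y at *
    generalize A 1 0 = w at *
    generalize A 1 1 = t at *
    generalize Z 0 0 = a at *
    generalize Z 0 1 = b at *
    generalize Z 1 0 = c at *
    grind

/-- the centralizer of a square root of -1 is cyclic -/
lemma sl_centralizer_cyclic {F : Type*} [Field F] [Finite F] (h2 : (2 : F) ≠ 0) (Z : SL(2, F))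
    (hZ : Z * Z = -1) : IsCyclic (Subgroup.centralizer {Z} : Subgroup SL(2, F)) := by
  have htr := sl_sq_neg_one Z hZ
  have hd := Z.det_coe
  rw [Matrix.det_fin_two, htr] at hd
  obtain ⟨i, hi⟩ := IsAlgClosed.exists_pow_nat_eq (-1 : AlgebraicClosure F) (n := 2) (by norm_num)
  have h2' : (2 : AlgebraicClosure F) ≠ 0 := by
    have := (algebraMap F (AlgebraicClosure F)).injective.ne h2
    rwa [map_zero, map_ofNat] at this
  -- every element is α + β Z
  have key := fun A : (Subgroup.centralizer {Z} : Subgroup SL(2, F)) => sl_decomp h2 Z A.1 hZ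
    (Subgroup.mem_centralizer_singleton_iff.mp A.2)
  choose α β h00 h01 h10 h11 using key
  have hα : ∀ A, 2 * α A = A.1 0 0 + A.1 1 1 := fun A => by rw [h00, h11]; ring
  have hβ : ∀ A, 2 * β A = -(A.1 0 0 * Z 0 0 + A.1 0 1 * Z 1 0 + A.1 1 0 * Z 0 1 - A.1 1 1 * Z 0 0) := fun A => by
    rw [h00, h11, h01, h10]; linear_combination (-2 * β A) * hd
  have cancel : ∀ x y : F, 2 * x = 2 * y → x = y := fun x y h => mul_left_cancel₀ h2 h
  let φ := algebraMap F (AlgebraicClosure F)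
  have hα1 : α 1 = 1 := cancel _ _ (by rw [hα]; simp; ring)
  have hβ1 : β 1 = 0 := cancel _ _ (by rw [hβ]; simp)
  have hαm : ∀ A B, α (A * B) = α A * α B - β A * β B := fun A B => cancel _ _ (by
    rw [hα]; simp [Matrix.mul_apply, Fin.sum_univ_two, h00, h01, h10, h11]
    linear_combination (-2 * β A * β B) * hd)
  have hβm : ∀ A B, β (A * B) = α A * β B + β A * α B := fun A B => cancel _ _ (by
    rw [hβ]; simp [Matrix.mul_apply, Fin.sum_univ_two, h00, h01, h10, h11]
    linear_combination (2 * (α A * β B + β A * α B)) * hd)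
  let f : (Subgroup.centralizer {Z} : Subgroup SL(2, F)) →* AlgebraicClosure F :=
    { toFun := fun A => φ (α A) + i * φ (β A)
      map_one' := by simp [hα1, hβ1]
      map_mul' := fun A B => by
        simp only [hαm, hβm, map_add, map_sub, map_mul]
        linear_combination (-φ (β A) * φ (β B)) * hi }
  refine isCyclic_of_injective_ringHom f ?_
  rw [injective_iff_map_eq_one]
  intro A hA
  have hA' : φ (α A) + i * φ (β A) = 1 := hA
  have dA := A.1.det_coe
  rw [Matrix.det_fin_two, h00, h01, h10, h11] at dA
  have n : α A ^ 2 + β A ^ 2 = 1 := by linear_combination dA - β A ^ 2 * hd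
  have n' : φ (α A) ^ 2 + φ (β A) ^ 2 = 1 := by
    rw [← map_pow, ← map_pow, ← map_add, n, map_one]
  have m : φ (α A) - i * φ (β A) = 1 := by
    have : (φ (α A) - i * φ (β A)) * (φ (α A) + i * φ (β A)) = 1 := by
      linear_combination n' - φ (β A) ^ 2 * hi
    rwa [hA', mul_one] at this
  have a1 : α A = 1 := by
    apply φ.injective
    apply mul_left_cancel₀ h2'
    rw [map_one]; linear_combination hA' + m
  have b1 : β A = 0 := by
    rw [a1] at n
    have : β A ^ 2 = 0 := by linear_combination n
    simpa using this
  apply Subtype.ext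
  rw [sl_entries, h00, h01, h10, h11, a1, b1]
  simp

lemma sl_anti {F : Type*} [Field F] (h2 : (2 : F) ≠ 0) (Z B A : SL(2, F))
    (hZ : Z * Z = -1) (hB : B * Z = -(Z * B)) (hA : A * Z = Z * A) :
    B * B = -1 ∧ B * A * B⁻¹ = A⁻¹ := by
  have htr := sl_sq_neg_one Z hZ
  have hd := Z.det_coe
  rw [Matrix.det_fin_two, htr] at hd
  obtain ⟨α, β, h00, h01, h10, h11⟩ := sl_decomp h2 Z A hZ hA
  rw [sl_entries] at hB
  simp only [Matrix.SpecialLinearGroup.coe_neg, Matrix.neg_apply,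
    Matrix.SpecialLinearGroup.coe_mul, Matrix.mul_apply, Fin.sum_univ_two, htr] at hB
  obtain ⟨e1, e2, e3, e4⟩ := hB
  constructor
  · apply sl_sq_of_trace
    have : 2 * (B 0 0 + B 1 1) = 0 := by
      linear_combination (-2 * (B 0 0 + B 1 1)) * hd - Z 0 0 * (e1 - e4) - 2 * Z 1 0 * e2
    have : B 0 0 + B 1 1 = 0 := by simpa [h2] using this
    linear_combination this
  · rw [mul_inv_eq_iff_eq_mul, sl_entries]
    simp [Matrix.mul_apply, Fin.sum_univ_two, Matrix.SpecialLinearGroup.coe_inv,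
      Matrix.adjugate_fin_two, h00, h01, h10, h11]
    refine ⟨?_, ?_, ?_, ?_⟩
    · linear_combination β * e1
    · linear_combination β * e2
    · linear_combination β * e3
    · linear_combination β * e4

lemma sl_cycle {F : Type*} [Field F] (h2 : (2 : F) ≠ 0) (A B : SL(2, F))
    (hA : A * A = -1) (hB : B * B = -1) (hAB : B * A = -(A * B)) :
    ∃ X : SL(2, F), X * A = B * X ∧ X * B = A * B * X := by
  have trA := sl_sq_neg_one A hA
  have trB := sl_sq_neg_one B hB
  have dA := A.det_coe
  have dB := B.det_coe
  rw [Matrix.det_fin_two, trA] at dA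
  rw [Matrix.det_fin_two, trB] at dB
  obtain ⟨h, hh⟩ : ∃ h : F, 2 * h = 1 := ⟨2⁻¹, mul_inv_cancel₀ h2⟩
  have mA : (A : Matrix (Fin 2) (Fin 2) F) * A = -1 := by
    rw [← Matrix.SpecialLinearGroup.coe_mul, hA]; simp
  have mB : (B : Matrix (Fin 2) (Fin 2) F) * B = -1 := by
    rw [← Matrix.SpecialLinearGroup.coe_mul, hB]; simp
  have mAB : (B : Matrix (Fin 2) (Fin 2) F) * A = -(A * B) := by
    rw [← Matrix.SpecialLinearGroup.coe_mul, hAB]; simp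
  have hAB' := hAB
  rw [sl_entries] at hAB'
  simp only [Matrix.SpecialLinearGroup.coe_neg, Matrix.neg_apply,
    Matrix.SpecialLinearGroup.coe_mul, Matrix.mul_apply, Fin.sum_univ_two, trA, trB] at hAB'
  obtain ⟨e1, e2, e3, e4⟩ := hAB'
  let M : Matrix (Fin 2) (Fin 2) F := 1 + A + B + A * B
  have hdet : (h • M).det = 1 := by
    rw [Matrix.det_fin_two]
    simp [M, Matrix.mul_apply, Fin.sum_univ_two, trA, trB]
    generalize A 0 0 = x at *
    generalize A 0 1 = y at *
    generalize A 1 0 = w at *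
    generalize B 0 0 = a at *
    generalize B 0 1 = b at *
    generalize B 1 0 = c at *
    grind
  refine ⟨⟨h • M, hdet⟩, ?_, ?_⟩
  · apply Subtype.ext
    change (h • M) * (A : Matrix (Fin 2) (Fin 2) F) = B * (h • M)
    rw [smul_mul_assoc, mul_smul_comm]
    congr 1
    have : (A : Matrix (Fin 2) (Fin 2) F) * B * A = B := by
      rw [mul_assoc, mAB, mul_neg, ← mul_assoc, mA]; simp
    have h3 : (B : Matrix (Fin 2) (Fin 2) F) * (A * B) = A := by
      rw [← mul_assoc, mAB, neg_mul, mul_assoc, mB]; simp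
    simp only [M, add_mul, mul_add, mA, mB, mAB, h3, this]
    simp; abel
  · apply Subtype.ext
    change (h • M) * (B : Matrix (Fin 2) (Fin 2) F) = A * B * (h • M)
    rw [smul_mul_assoc, mul_smul_comm]
    congr 1
    have h1 : (A : Matrix (Fin 2) (Fin 2) F) * B * A = B := by
      rw [mul_assoc, mAB, mul_neg, ← mul_assoc, mA]; simp
    have h3 : (A : Matrix (Fin 2) (Fin 2) F) * B * B = -A := by
      rw [mul_assoc, mB]; simp
    have h4 : (A : Matrix (Fin 2) (Fin 2) F) * B * (A * B) = -1 := by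
      rw [← mul_assoc, h1, mB]
    simp only [M, add_mul, mul_add, mB, h1, h3, h4]
    simp; abel

lemma psl_card {F : Type*} [Field F] [Fintype F] (h2 : (2 : F) ≠ 0) :
    2 * Nat.card PSL(2, F) = Fintype.card F * (Fintype.card F ^ 2 - 1) := by
  have h1 : Nat.card SL(2, F) = Fintype.card F * (Fintype.card F ^ 2 - 1) := by
    have e : SL(2, F) ≃ (Matrix.GeneralLinearGroup.det (n := Fin 2) (R := F)).ker :=
      { toFun := fun A => ⟨A, by rw [MonoidHom.mem_ker]; ext; simp⟩
        invFun := fun A => ⟨A.1, by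
          have := congrArg Units.val (MonoidHom.mem_ker.mp A.2)
          simpa using this⟩
        left_inv := fun A => by ext; simp
        right_inv := fun A => by ext; rfl }
    have hsurj : Function.Surjective (Matrix.GeneralLinearGroup.det (n := Fin 2) (R := F)) := by
      intro u
      refine ⟨Matrix.GeneralLinearGroup.mkOfDetNeZero !![(u : F), 0; 0, 1] (by simp), ?_⟩
      ext; simp [Matrix.GeneralLinearGroup.mkOfDetNeZero]
    have hc := Subgroup.card_eq_card_quotient_mul_card_subgroup
      (Matrix.GeneralLinearGroup.det (n := Fin 2) (R := F)).ker
    rw [Nat.card_congr (QuotientGroup.quotientKerEquivOfSurjective _ hsurj).toEquiv,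
      ← Nat.card_congr e, Matrix.card_GL_field, Nat.card_units, Nat.card_eq_fintype_card, Fin.prod_univ_two] at hc
    have hF : 1 < Fintype.card F := Fintype.one_lt_card
    apply Nat.eq_of_mul_eq_mul_left (Nat.sub_pos_of_lt hF)
    rw [← hc]
    simp only [Fin.val_zero, Fin.val_one, pow_zero, pow_one, sq, ← Nat.mul_sub_one]
    ring
  have h3 : Nat.card (Subgroup.center SL(2, F)) = 2 := by
    have : ((Subgroup.center SL(2, F) : Subgroup _) : Set SL(2, F)) = {1, -1} := by
      ext A; simp [psl_mem_center]
    rw [← SetLike.coe_sort_coe, this, Nat.card_coe_set_eq, Set.ncard_pair]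
    intro h
    rw [sl_entries] at h
    have := h.1
    simp at this
    apply h2
    linear_combination this
  rw [← h1, Subgroup.card_eq_card_quotient_mul_card_subgroup (Subgroup.center SL(2, F)), h3, mul_comm]

/-- Every involution lies in a cyclic torus of index at most two in its centralizer. -/
def HasTori (G : Type*) [Group G] : Prop :=
  ∀ z : G, z ≠ 1 → z * z = 1 → ∃ T : Subgroup G, IsCyclic T ∧ z ∈ T ∧
    (∀ g, g * z = z * g → g ∉ T → g * g = 1 ∧ ∀ t ∈ T, g * t * g⁻¹ = t⁻¹) ∧
    (∀ g h, g * z = z * g → h * z = z * h → g ∉ T → h ∉ T → g * h ∈ T)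

/-- Commuting involutions are cyclically permuted. -/
def HasCycles (G : Type*) [Group G] : Prop :=
  ∀ u z : G, u ≠ 1 → z ≠ 1 → u ≠ z → u * u = 1 → z * z = 1 → u * z = z * u →
    ∃ n : G, n * u = z * n ∧ n * z = u * z * n

lemma psl_involution {F : Type*} [Field F] (h2 : (2 : F) ≠ 0) (Z : SL(2, F))
    (h1 : (QuotientGroup.mk Z : PSL(2, F)) ≠ 1)
    (h : (QuotientGroup.mk Z : PSL(2, F)) * QuotientGroup.mk Z = 1) : Z * Z = -1 := by
  rw [Ne, psl_mk_eq_one] at h1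
  rw [← QuotientGroup.mk_mul, psl_mk_eq_one] at h
  exact h.resolve_left fun h => h1 (sl_sq_one h2 Z h)

lemma psl_hasTori {F : Type*} [Field F] [Finite F] (h2 : (2 : F) ≠ 0) : HasTori PSL(2, F) := by
  intro z hz1 hz
  induction z using QuotientGroup.induction_on with | _ Z
  have hZ := psl_involution h2 Z hz1 hz
  have := sl_centralizer_cyclic h2 Z hZ
  have comm : ∀ A : SL(2, F), (QuotientGroup.mk A : PSL(2, F)) * QuotientGroup.mk Z =
      QuotientGroup.mk Z * QuotientGroup.mk A →
      (QuotientGroup.mk A : PSL(2, F)) ∉ (Subgroup.centralizer {Z}).map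
        (QuotientGroup.mk' (Subgroup.center SL(2, F))) → A * Z = -(Z * A) := by
    intro A h hn
    rw [← QuotientGroup.mk_mul, ← QuotientGroup.mk_mul, psl_mk_eq] at h
    rcases h with h | h
    · exact absurd ⟨A, Subgroup.mem_centralizer_singleton_iff.mpr h.symm, rfl⟩ hn
    · rw [h, neg_neg]
  refine ⟨(Subgroup.centralizer {Z}).map (QuotientGroup.mk' _), ?_, ?_, ?_, ?_⟩
  · exact isCyclic_of_surjective _ (MonoidHom.subgroupMap_surjective
      (QuotientGroup.mk' (Subgroup.center SL(2, F))) (Subgroup.centralizer {Z}))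
  · exact ⟨Z, Subgroup.mem_centralizer_singleton_iff.mpr rfl, rfl⟩
  · intro g hg hn
    induction g using QuotientGroup.induction_on with | _ B
    have hB := comm B hg hn
    refine ⟨?_, ?_⟩
    · rw [← QuotientGroup.mk_mul, psl_mk_eq_one]
      exact Or.inr (sl_anti h2 Z B 1 hZ hB (by simp)).1
    · rintro _ ⟨A, hA, rfl⟩
      have := (sl_anti h2 Z B A hZ hB (Subgroup.mem_centralizer_singleton_iff.mp hA)).2
      exact congrArg (QuotientGroup.mk' (Subgroup.center SL(2, F))) this
  · intro g h hg hh hgn hhn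
    induction g using QuotientGroup.induction_on with | _ A
    induction h using QuotientGroup.induction_on with | _ B
    have hA := comm A hg hgn
    have hB := comm B hh hhn
    refine ⟨A * B, Subgroup.mem_centralizer_singleton_iff.mpr ?_, rfl⟩
    rw [mul_assoc, hB, mul_neg, ← mul_assoc, hA, neg_mul, neg_neg, mul_assoc]

lemma psl_hasCycles {F : Type*} [Field F] (h2 : (2 : F) ≠ 0) : HasCycles PSL(2, F) := by
  intro u z hu1 hz1 huz hu hz hcomm
  induction u using QuotientGroup.induction_on with | _ U
  induction z using QuotientGroup.induction_on with | _ Z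
  have hU := psl_involution h2 U hu1 hu
  have hZ := psl_involution h2 Z hz1 hz
  rw [← QuotientGroup.mk_mul, ← QuotientGroup.mk_mul, psl_mk_eq] at hcomm
  have h : Z * U = -(U * Z) := by
    refine hcomm.resolve_left fun h => huz ?_
    have : (U * Z) * (U * Z) = 1 := by
      rw [mul_assoc, ← mul_assoc Z, h, mul_assoc U, hZ, ← mul_assoc, mul_neg_one, hU]
      simp
    rw [psl_mk_eq]
    have hUi : U⁻¹ = -U := inv_eq_of_mul_eq_one_left (by rw [neg_mul, hU, neg_neg])
    rcases sl_sq_one h2 _ this with h | h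
    · right; rw [← hUi]; exact (inv_eq_of_mul_eq_one_right h).symm
    · left
      have : U * (-Z) = 1 := by rw [mul_neg, h, neg_neg]
      have := inv_eq_of_mul_eq_one_right this
      rw [hUi, neg_inj] at this
      exact this.symm
  obtain ⟨X, h1, h3⟩ := sl_cycle h2 U Z hU hZ h
  exact ⟨QuotientGroup.mk X, congrArg (QuotientGroup.mk' (Subgroup.center SL(2, F))) h1,
    congrArg (QuotientGroup.mk' (Subgroup.center SL(2, F))) h3⟩

section abstract_group

variable {G : Type*} [Group G]

lemma mem_conjugate {H : Subgroup G} {g x : G} : x ∈ H.conjugate g ↔ g * x * g⁻¹ ∈ H := by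
  unfold Subgroup.conjugate
  constructor
  · rintro ⟨h, hh, rfl⟩
    simpa [mul_assoc] using hh
  · intro h
    exact ⟨_, h, by simp [mul_assoc]⟩

lemma conjugate_mul (H : Subgroup G) (g h : G) :
    (H.conjugate g).conjugate h = H.conjugate (g * h) := by
  ext x; simp only [mem_conjugate, _root_.mul_inv_rev, mul_assoc]

lemma conjugate_one (H : Subgroup G) : H.conjugate 1 = H := by
  ext x; simp [mem_conjugate]

lemma card_conjugate (H : Subgroup G) (g : G) : Nat.card (H.conjugate g) = Nat.card H :=
  (Nat.card_congr (H.equivMapOfInjective (MulAut.conj g⁻¹).toMonoidHom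
    (MulAut.conj g⁻¹).injective).toEquiv).symm

lemma conjugate_cyclic (H : Subgroup G) (g : G) (h : IsCyclic (H.conjugate g)) : IsCyclic H :=
  have : IsCyclic (H.map (MulAut.conj g⁻¹).toMonoidHom) := h
  isCyclic_of_surjective _ (H.equivMapOfInjective (MulAut.conj g⁻¹).toMonoidHom
    (MulAut.conj g⁻¹).injective).symm.surjective

lemma pronormal_of_weak [Finite G] (H : Subgroup G) (hH : IsPGroup 2 H)
    (hw : ∀ (P : Subgroup G) (g : G), IsPGroup 2 P → H ≤ P → H.conjugate g ≤ P →
      H.conjugate g = H) : IsPronormal H := by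
  intro g
  set K := H ⊔ H.conjugate g with hK
  have hHK : H ≤ K := le_sup_left
  have hgK : H.conjugate g ≤ K := le_sup_right
  have hHg : IsPGroup 2 (H.conjugate g) := hH.map _
  have : Fact (Nat.Prime 2) := ⟨Nat.prime_two⟩
  obtain ⟨P, hP⟩ := IsPGroup.exists_le_sylow
    (hH.of_equiv (Subgroup.subgroupOfEquivOfLe hHK).symm)
  obtain ⟨Q, hQ⟩ := IsPGroup.exists_le_sylow
    (hHg.of_equiv (Subgroup.subgroupOfEquivOfLe hgK).symm)
  obtain ⟨y, hy⟩ := MulAction.exists_smul_eq K Q P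
  have e := hw (P.1.map K.subtype) (g * (y : G)⁻¹) (P.2.map _) ?_ ?_
  · refine ⟨y, y.2, ?_⟩
    conv_lhs => rw [← e]
    rw [conjugate_mul]; simp
  · intro x hx
    exact ⟨⟨x, hHK hx⟩, hP (Subgroup.mem_subgroupOf.mpr hx), rfl⟩
  · intro x hx
    rw [← conjugate_mul, mem_conjugate, inv_inv] at hx
    have h1 : (⟨_, hgK hx⟩ : K) ∈ (Q : Subgroup K) := hQ (Subgroup.mem_subgroupOf.mpr hx)
    refine ⟨y * ⟨_, hgK hx⟩ * y⁻¹, ?_, ?_⟩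
    · rw [← hy]
      exact Subgroup.smul_mem_pointwise_smul _ (MulAut.conj y) _ h1
    · simp [mul_assoc]

lemma cyc_mem [Finite G] (T D : Subgroup G) (hT : IsCyclic T) (hD : D ≤ T) (x : G) (hx : x ∈ T)
    (h : x ^ Nat.card D = 1) : x ∈ D := by
  classical
  have := Fintype.ofFinite T
  have hc := IsCyclic.card_pow_eq_one_le (α := T) (n := Nat.card D) Nat.card_pos
  have := Fintype.ofFinite (D.subgroupOf T)
  have hsub : (Finset.univ.filter fun a : T => a ∈ D.subgroupOf T) ⊆
      Finset.univ.filter fun a : T => a ^ Nat.card D = 1 := by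
    intro a ha
    simp only [Finset.mem_filter, Finset.mem_univ, true_and] at ha ⊢
    apply Subtype.ext
    exact congrArg (Subtype.val : D → G) (pow_card_eq_one' (x := (⟨a, ha⟩ : D)))
  have hcard : (Finset.univ.filter fun a : T => a ∈ D.subgroupOf T).card = Nat.card D := by
    rw [← Nat.card_congr (Subgroup.subgroupOfEquivOfLe hD).toEquiv, ← Fintype.card_subtype,
      Nat.card_eq_fintype_card]
  have := Finset.eq_of_subset_of_card_le hsub (by rw [hcard]; exact hc)
  have hx' : (⟨x, hx⟩ : T) ∈ Finset.univ.filter fun a : T => a ^ Nat.card D = 1 := by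
    simp only [Finset.mem_filter, Finset.mem_univ, true_and]
    exact Subtype.ext (by simpa using h)
  rw [← this] at hx'
  simpa [Subgroup.mem_subgroupOf] using hx'

lemma cyc_eq [Finite G] (T D E : Subgroup G) (hT : IsCyclic T) (hD : D ≤ T) (hE : E ≤ T)
    (h : Nat.card D = Nat.card E) : D = E := by
  have key : ∀ D E : Subgroup G, D ≤ T → E ≤ T → Nat.card D = Nat.card E → D ≤ E := by
    intro D E hD hE h x hx
    refine cyc_mem T E hT hE x (hD hx) ?_
    rw [← h]
    exact congrArg Subtype.val (pow_card_eq_one' (x := (⟨x, hx⟩ : D)))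
  exact le_antisymm (key _ _ hD hE h) (key _ _ hE hD h.symm)

lemma central_involution [Finite G] (P : Subgroup G) (hP : IsPGroup 2 P) (hne : P ≠ ⊥) :
    ∃ z ∈ P, z ≠ 1 ∧ z * z = 1 ∧ ∀ g ∈ P, g * z = z * g := by
  have : Fact (Nat.Prime 2) := ⟨Nat.prime_two⟩
  have : Nontrivial P := (Subgroup.nontrivial_iff_ne_bot P).mpr hne
  have hc := hP.center_nontrivial
  have hC : IsPGroup 2 (Subgroup.center P) := hP.to_subgroup _
  obtain ⟨n, hn, hcard⟩ := hC.nontrivial_iff_card.mp hc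
  obtain ⟨z, hz⟩ := exists_prime_orderOf_dvd_card' (G := Subgroup.center P) 2
    (by rw [hcard]; exact dvd_pow_self 2 hn.ne')
  refine ⟨z, z.1.2, ?_, ?_, ?_⟩
  · intro h
    have : z = 1 := by ext; simpa using h
    rw [this] at hz; simp at hz
  · have := pow_orderOf_eq_one z
    rw [hz, sq] at this
    simpa using congrArg (fun x : Subgroup.center P => (x : G)) this
  · intro g hg
    have := Subgroup.mem_center_iff.mp z.2 ⟨g, hg⟩
    simpa using congrArg Subtype.val this

lemma part_one [Finite G] (hG : HasTori G) (a : ℕ) (ha : 2 ≤ a) (H : Subgroup G)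
    (hc : IsCyclic H) (hcard : Nat.card H = 2 ^ a) : IsPronormal H := by
  refine pronormal_of_weak H (IsPGroup.of_card hcard) fun P g hP hHP hgP => ?_
  have hne : P ≠ ⊥ := by
    rintro rfl
    have : H = ⊥ := le_bot_iff.mp hHP
    rw [this, Subgroup.card_bot] at hcard
    exact absurd hcard.symm (Nat.one_lt_two_pow (by omega)).ne'
  obtain ⟨z, hzP, hz1, hz, hcomm⟩ := central_involution P hP hne
  obtain ⟨T, hT, hzT, hinv, hmul⟩ := hG z hz1 hz
  have key : ∀ E : Subgroup G, IsCyclic E → Nat.card E = 2 ^ a → E ≤ P → E ≤ T := by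
    intro E hE hEc hEP
    obtain ⟨x, hx⟩ := hE.exists_generator
    have hxT : (x : G) ∈ T := by
      by_contra hn
      have h1 := (hinv x (hcomm _ (hEP x.2)) hn).1
      have h2 : x ^ 2 = 1 := by ext; simpa [sq] using h1
      have h3 := orderOf_dvd_of_pow_eq_one h2
      rw [orderOf_eq_card_of_forall_mem_zpowers hx, hEc] at h3
      have h4 := Nat.le_of_dvd (by norm_num) h3
      have h5 : 2 ^ 2 ≤ 2 ^ a := Nat.pow_le_pow_right (by norm_num) ha
      omega
    intro y hy
    obtain ⟨m, hm⟩ := Subgroup.mem_zpowers_iff.mp (hx ⟨y, hy⟩)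
    have : (x : G) ^ m = y := by simpa using congrArg Subtype.val hm
    rw [← this]; exact T.zpow_mem hxT m
  have hcg : IsCyclic (H.conjugate g) := isCyclic_of_surjective _
    (H.equivMapOfInjective _ (MulAut.conj g⁻¹).injective).surjective
  exact cyc_eq T _ _ hT (key _ hcg (by rw [card_conjugate, hcard]) hgP) (key _ hc hcard hHP)
    (card_conjugate H g)

lemma part_sylow [Finite G] (H : Subgroup G)
    (hcard : Nat.card H = 2 ^ (Nat.card G).factorization 2) : IsPronormal H := by
  have : Fact (Nat.Prime 2) := ⟨Nat.prime_two⟩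
  refine pronormal_of_weak H (IsPGroup.of_card hcard) fun P g hP hHP hgP => ?_
  have h1 : H = P := ((Sylow.ofCard H hcard).3 hP hHP).symm
  have h2 : H.conjugate g = P :=
    ((Sylow.ofCard (H.conjugate g) ((card_conjugate H g).trans hcard)).3 hP hgP).symm
  rw [h2, ← h1]

/-- index two intersection -/
lemma card_inf_torus [Finite G] (E T : Subgroup G) (j : G) (hj : j ∈ E) (hjT : j ∉ T)
    (hmul : ∀ g ∈ E, ∀ h ∈ E, g ∉ T → h ∉ T → g * h ∈ T) :
    Nat.card E = 2 * Nat.card (E ⊓ T : Subgroup G) := by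
  have h1 : (T.subgroupOf E).index = 2 := by
    rw [Subgroup.index_eq_two_iff]
    refine ⟨⟨j, hj⟩, fun b => ?_⟩
    simp only [Subgroup.mem_subgroupOf, Subgroup.coe_mul]
    by_cases hb : (b : G) ∈ T
    · exact Or.inr ⟨hb, fun h => hjT ((T.mul_mem_cancel_left hb).mp h)⟩
    · exact Or.inl ⟨hmul _ b.2 _ hj hb hjT, hb⟩
  have h2 := (T.subgroupOf E).card_mul_index
  have h3 : Nat.card (T.subgroupOf E) = Nat.card (E ⊓ T : Subgroup G) := by
    rw [← Subgroup.inf_subgroupOf_left]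
    exact Nat.card_congr (Subgroup.subgroupOfEquivOfLe inf_le_left).toEquiv
  rw [← h2, h1, h3, mul_comm]

/-- If `E` is non-cyclic of order `2^(k-1)` and contains involutions `u`, `z` with `u` conjugate of
the central one, we can move `u` to `z` inside the normalizer of `E`. -/
lemma four_group_move [Finite G] (hC : HasCycles G) (E : Subgroup G) (hE : Nat.card E = 4) (u z : G)
    (hu : u ∈ E) (hz : z ∈ E) (hu1 : u ≠ 1) (hz1 : z ≠ 1) (huz : u ≠ z) (huu : u * u = 1)
    (hzz : z * z = 1) (hc : u * z = z * u) :
    ∃ n : G, n * u * n⁻¹ = z ∧ E.conjugate n⁻¹ = E := by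
  obtain ⟨n, h1, h2⟩ := hC u z hu1 hz1 huz huu hzz hc
  refine ⟨n, by rw [h1]; simp, ?_⟩
  have hne : u * z ≠ 1 := fun h => huz (by
    have := congrArg (· * z) h; simpa [mul_assoc, hzz] using this)
  have hset : ({1, u, z, u * z} : Set G) = E := by
    apply Set.eq_of_subset_of_ncard_le
    · rintro x (rfl | rfl | rfl | rfl)
      exacts [E.one_mem, hu, hz, E.mul_mem hu hz]
    · rw [← Nat.card_coe_set_eq, SetLike.coe_sort_coe, hE]
      rw [Set.ncard_insert_of_notMem, Set.ncard_insert_of_notMem, Set.ncard_pair]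
      · simpa using hu1
      · simp [huz, hz1]
      · simp [hu1.symm, hz1.symm, hne.symm]
    · exact Set.toFinite _
  have hle : E.conjugate n⁻¹ ≤ E := by
    intro x hx
    rw [mem_conjugate, inv_inv] at hx
    have hx' : n⁻¹ * x * n ∈ ({1, u, z, u * z} : Set G) := by rw [hset]; exact hx
    have back : ∀ w, n⁻¹ * x * n = w → x = n * w * n⁻¹ := fun w h => by rw [← h]; simp [mul_assoc]
    rcases hx' with h | h | h | h
    · rw [back _ h]; simp
    · rw [back _ h, h1]; simpa using hz
    · rw [back _ h, h2]; simpa using E.mul_mem hu hz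
    · rw [back _ h, ← mul_assoc, h1, mul_assoc z, h2]
      simpa [← mul_assoc] using E.mul_mem (E.mul_mem hz hu) hz
  exact Subgroup.eq_of_le_of_card_ge hle (card_conjugate E _).ge

lemma part_half [Finite G] (hG : HasTori G) (hC : HasCycles G) (k : ℕ)
    (hk : k = (Nat.card G).factorization 2) (hk3 : 3 ≤ k) (H : Subgroup G)
    (hcard : Nat.card H = 2 ^ (k - 1)) (hnc : ¬ IsCyclic H) : IsPronormal H := by
  have : Fact (Nat.Prime 2) := ⟨Nat.prime_two⟩
  refine pronormal_of_weak H (IsPGroup.of_card hcard) fun P g hP hHP hgP => ?_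
  obtain ⟨m, rfl⟩ : ∃ m, k = m + 3 := ⟨k - 3, by omega⟩
  have e1 : m + 3 - 1 = m + 2 := by omega
  rw [e1] at hcard
  -- card of P
  by_cases hPc : Nat.card P = 2 ^ (m + 2)
  · have h1 : H = P := Subgroup.eq_of_le_of_card_ge hHP (by rw [hPc, hcard])
    have h2 : H.conjugate g = P :=
      Subgroup.eq_of_le_of_card_ge hgP (by rw [card_conjugate, hPc, hcard])
    rw [h2, ← h1]
  have hPc' : Nat.card P = 2 ^ (m + 3) := by
    obtain ⟨r, hr⟩ := IsPGroup.iff_card.mp hP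
    have h1 : 2 ^ (m + 2) ∣ 2 ^ r := by
      rw [← hr, ← hcard]; exact Subgroup.card_dvd_of_le hHP
    have h2 : r ≤ m + 3 := by
      rw [hk]
      have : 2 ^ r ∣ Nat.card G := by rw [← hr]; exact Subgroup.card_subgroup_dvd_card P
      exact (Nat.prime_two.pow_dvd_iff_le_factorization Nat.card_pos.ne').mp this
    have h3 := (Nat.pow_dvd_pow_iff_le_right (by norm_num)).mp h1
    have : r ≠ m + 2 := fun h => hPc (by rw [hr, h])
    rw [hr]; congr 1; omega
  set H' := H.conjugate g with hH'
  have hcard' : Nat.card H' = 2 ^ (m + 2) := by rw [card_conjugate, hcard]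
  have hnc' : ¬ IsCyclic H' := fun h => hnc (conjugate_cyclic H g h)
  have hne : P ≠ ⊥ := by
    rintro rfl
    rw [Subgroup.card_bot] at hPc'
    exact absurd hPc'.symm (Nat.one_lt_two_pow (by omega)).ne'
  obtain ⟨z, hzP, hz1, hz, hcomm⟩ := central_involution P hP hne
  obtain ⟨T, hT, hzT, hinv, hmul⟩ := hG z hz1 hz
  have exj : ∀ E : Subgroup G, ¬ IsCyclic E → ∃ j ∈ E, j ∉ T := by
    intro E hE
    by_contra! h
    exact hE (isCyclic_of_injective (Subgroup.inclusion h) (Subgroup.inclusion_injective h))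
  obtain ⟨j, hjH, hjT⟩ := exj H hnc
  obtain ⟨j', hjH', hjT'⟩ := exj H' hnc'
  have hmulP : ∀ g ∈ P, ∀ h ∈ P, g ∉ T → h ∉ T → g * h ∈ T := fun g hg h hh =>
    hmul g h (hcomm g hg) (hcomm h hh)
  have cP := card_inf_torus P T j (hHP hjH) hjT hmulP
  have cH := card_inf_torus H T j hjH hjT fun g hg h hh => hmulP g (hHP hg) h (hHP hh)
  have cH' := card_inf_torus H' T j' hjH' hjT' fun g hg h hh => hmulP g (hgP hg) h (hgP hh)
  rw [hPc', pow_succ] at cP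
  rw [hcard, pow_succ] at cH
  rw [hcard', pow_succ] at cH'
  have cP1 : Nat.card (P ⊓ T : Subgroup G) = 2 ^ (m + 2) := by omega
  have cH1 : Nat.card (H ⊓ T : Subgroup G) = 2 ^ (m + 1) := by omega
  have cH1' : Nat.card (H' ⊓ T : Subgroup G) = 2 ^ (m + 1) := by omega
  have hD : H' ⊓ T = H ⊓ T := cyc_eq T _ _ hT inf_le_right inf_le_right (by rw [cH1, cH1'])
  have hzD : z ∈ H ⊓ T := by
    refine cyc_mem T _ hT inf_le_right z hzT ?_
    rw [cH1, pow_succ', pow_mul, sq, hz, one_pow]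
  have hzH' : z ∈ H' := by rw [← hD] at hzD; exact hzD.1
  have inv_j : ∀ x, x ∈ P → x ∉ T → x⁻¹ = x := fun x hx hxT =>
    inv_eq_of_mul_eq_one_left (hinv x (hcomm x hx) hxT).1
  have hjj'T : j * j' ∈ T := hmulP j (hHP hjH) j' (hgP hjH') hjT hjT'
  by_cases hjj' : j * j' ∈ H ⊓ T
  · have hj'H : j' ∈ H := (H.mul_mem_cancel_left hjH).mp hjj'.1
    refine Subgroup.eq_of_le_of_card_ge ?_ (by rw [hcard, hcard'])
    intro x hx
    by_cases hxT : x ∈ T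
    · have : x ∈ H' ⊓ T := ⟨hx, hxT⟩
      rw [hD] at this; exact this.1
    · have : x * j' ∈ H' ⊓ T := ⟨H'.mul_mem hx hjH', hmulP x (hgP hx) j' (hgP hjH') hxT hjT'⟩
      rw [hD] at this
      exact (H.mul_mem_cancel_right hj'H).mp this.1
  exfalso
  -- find a conjugating element centralizing z
  set u := g⁻¹ * z * g with hu
  have huH' : u ∈ H' := by
    rw [hH', mem_conjugate]; simpa [hu, mul_assoc] using hzD.1
  have hu1 : u ≠ 1 := by
    intro h
    apply hz1
    have : z = g * u * g⁻¹ := by simp [hu, mul_assoc]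
    rw [this, h]; simp
  have huu : u * u = 1 := by
    have : u * u = g⁻¹ * (z * z) * g := by simp [hu, mul_assoc]
    rw [this, hz]; simp
  have move : ∃ n : G, n * u * n⁻¹ = z ∧ H'.conjugate n⁻¹ = H' := by
    by_cases huz : u = z
    · exact ⟨1, by simp [huz], by simp [conjugate_one]⟩
    rcases Nat.eq_zero_or_pos m with hm | hm
    · subst hm
      exact four_group_move hC H' hcard' u z huH' hzH' hu1 hz1 huz huu hz (hcomm u (hgP huH'))
    · exfalso
      apply huz
      -- a generator of H ⊓ T
      have hcyc : IsCyclic (H ⊓ T : Subgroup G) := isCyclic_of_injective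
        (Subgroup.inclusion (inf_le_right : H ⊓ T ≤ T)) (Subgroup.inclusion_injective _)
      obtain ⟨d, hd⟩ := hcyc.exists_generator
      obtain ⟨l, hl⟩ := Subgroup.mem_zpowers_iff.mp (hd ⟨z, hzD⟩)
      have hl' : (d : G) ^ l = z := by simpa using congrArg Subtype.val hl
      have hdg : g⁻¹ * (d : G) * g ∈ H' := by
        rw [hH', mem_conjugate]; simpa [mul_assoc] using d.2.1
      have hdT : g⁻¹ * (d : G) * g ∈ T := by
        by_contra hn
        have h1 := (hinv _ (hcomm _ (hgP hdg)) hn).1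
        have h2 : (d : G) * d = 1 := by
          have : (d : G) * d = g * ((g⁻¹ * (d : G) * g) * (g⁻¹ * (d : G) * g)) * g⁻¹ := by
            simp [mul_assoc]
          rw [this, h1]; simp
        have h3 : d ^ 2 = 1 := by ext; simpa [sq] using h2
        have h4 := orderOf_dvd_of_pow_eq_one h3
        rw [orderOf_eq_card_of_forall_mem_zpowers hd, cH1] at h4
        have h5 := Nat.le_of_dvd (by norm_num) h4
        have h6 : 2 ^ 2 ≤ 2 ^ (m + 1) := Nat.pow_le_pow_right (by norm_num) (by omega)
        omega
      have huT : u ∈ T := by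
        have : u = (g⁻¹ * (d : G) * g) ^ l := by
          have := conj_zpow (i := l) (a := g⁻¹) (b := (d : G))
          rw [inv_inv] at this
          rw [this, hl']
        rw [this]; exact T.zpow_mem hdT l
      have hz2 : orderOf z = 2 := orderOf_eq_prime (by rw [sq, hz]) hz1
      have : u ∈ Subgroup.zpowers z := by
        refine cyc_mem T _ hT (by simpa using hzT) u huT ?_
        rw [Nat.card_zpowers, hz2, sq, huu]
      classical
      obtain ⟨w, hw, hwu⟩ := Finset.mem_image.mp (mem_zpowers_iff_mem_range_orderOf.mp this)
      rw [hz2, Finset.mem_range] at hw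
      have : w = 0 ∨ w = 1 := by omega
      rcases this with h | h
      · rw [h, pow_zero] at hwu; exact absurd hwu.symm hu1
      · rw [h, pow_one] at hwu; exact hwu.symm
  obtain ⟨n, hn, hnH'⟩ := move
  have ex2 : ∃ c : G, c * z = z * c ∧ c ∈ T ∧ H.conjugate c = H' := by
    have h1 : g * n⁻¹ * z = z * (g * n⁻¹) := by
      have : u = n⁻¹ * z * n := by rw [← hn]; simp [mul_assoc]
      have h2 : g⁻¹ * z * g = n⁻¹ * z * n := this
      calc g * n⁻¹ * z = g * (n⁻¹ * z * n) * n⁻¹ := by simp [mul_assoc]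
        _ = z * (g * n⁻¹) := by rw [← h2]; simp [mul_assoc]
    have h3 : H.conjugate (g * n⁻¹) = H' := by rw [← conjugate_mul, ← hH', hnH']
    by_cases h : g * n⁻¹ ∈ T
    · exact ⟨_, h1, h, h3⟩
    · have hj'z := hcomm j' (hgP hjH')
      refine ⟨g * n⁻¹ * j', ?_, hmul _ _ h1 hj'z h hjT', ?_⟩
      · rw [mul_assoc, hj'z, ← mul_assoc, h1, mul_assoc]
      · rw [← conjugate_mul, h3]
        ext x
        rw [mem_conjugate, H'.mul_mem_cancel_right (H'.inv_mem hjH'), H'.mul_mem_cancel_left hjH']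
  obtain ⟨c, hcz, hcT, hcH⟩ := ex2
  have hjc := (hinv j (hcomm j (hHP hjH)) hjT).2 c hcT
  have hy : c⁻¹ * j * c ∈ H' := by
    rw [← hcH, mem_conjugate]; simpa [mul_assoc] using hjH
  have hyT : c⁻¹ * j * c ∉ T := by
    rwa [T.mul_mem_cancel_right hcT, T.mul_mem_cancel_left (T.inv_mem hcT)]
  have hyj : c⁻¹ * j * c * j' ∈ H ⊓ T := by
    rw [← hD]
    exact ⟨H'.mul_mem hy hjH', hmulP _ (hgP hy) _ (hgP hjH') hyT hjT'⟩
  have e2 : c⁻¹ * j * c * j' = (c * c)⁻¹ * (j * j') := by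
    have : j * c = c⁻¹ * j := by rw [← hjc]; simp
    rw [mul_assoc c⁻¹, this]; simp [mul_assoc]
  rw [e2] at hyj
  -- c * c lies in P ⊓ T but not in H ⊓ T
  have hcc : c * c ∉ H ⊓ T := fun h =>
    hjj' (((H ⊓ T).mul_mem_cancel_left ((H ⊓ T).inv_mem h)).mp hyj)
  have hccP : c * c ∈ P ⊓ T := by
    have hle : H ⊓ T ≤ P ⊓ T := inf_le_inf_right _ hHP
    have h1 := (P ⊓ T).mul_mem (⟨P.mul_mem (hHP hjH) (hgP hjH'), hjj'T⟩ : j * j' ∈ P ⊓ T)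
      ((P ⊓ T).inv_mem (hle hyj))
    have e3 : j * j' * ((c * c)⁻¹ * (j * j'))⁻¹ = c * c := by
      rw [_root_.mul_inv_rev, inv_inv, mul_inv_cancel_left]
    rwa [e3] at h1
  have o1 : c ^ 2 ^ (m + 3) = 1 := by
    have := congrArg Subtype.val (pow_card_eq_one' (x := (⟨_, hccP⟩ : (P ⊓ T : Subgroup G))))
    rw [cP1] at this
    rw [pow_succ', pow_mul, sq]; simpa using this
  have o2 : ¬ c ^ 2 ^ (m + 2) = 1 := by
    intro h
    apply hcc
    refine cyc_mem T _ hT inf_le_right _ (T.mul_mem hcT hcT) ?_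
    rw [cH1, ← sq, ← pow_mul, ← pow_succ', h]
  have ho : orderOf c = 2 ^ (m + 3) := orderOf_eq_prime_pow o2 o1
  have hz' : Nat.card (Subgroup.zpowers c) = 2 ^ (Nat.card G).factorization 2 := by
    rw [Nat.card_zpowers, ho, ← hk]
  have hP' : Nat.card P = 2 ^ (Nat.card G).factorization 2 := by rw [hPc', ← hk]
  have eqv : Subgroup.zpowers c ≃* P := Sylow.equiv (Sylow.ofCard _ hz') (Sylow.ofCard P hP')
  have hPcyc : IsCyclic P := isCyclic_of_surjective eqv eqv.surjective
  exact hnc (isCyclic_of_injective (Subgroup.inclusion hHP) (Subgroup.inclusion_injective _))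

end abstract_group

theorem stmt13 (p n q : ℕ) (hp : p.Prime) (hq : q = p ^ n) (hodd : Odd q)
    (hmod : q % 8 = 1 ∨ q % 8 = 7)
    (F : Type*) [Field F] [Fintype F] (hF : Fintype.card F = q)
    (k : ℕ)
    (hk : k = (Nat.card (Matrix.ProjectiveSpecialLinearGroup (Fin 2) F)).factorization 2) :
    (∀ (a : ℕ), 2 ≤ a →
      ∀ H : Subgroup (Matrix.ProjectiveSpecialLinearGroup (Fin 2) F),
        IsCyclic H → Nat.card H = 2 ^ a → IsPronormal H) ∧
    (∀ H : Subgroup (Matrix.ProjectiveSpecialLinearGroup (Fin 2) F),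
      (Nonempty (H ≃* DihedralGroup (2 ^ (k - 2))) ∨
        Nonempty (H ≃* DihedralGroup (2 ^ (k - 1)))) → IsPronormal H) := by
  have h2 : (2 : F) ≠ 0 := by
    apply Ring.two_ne_zero
    intro h
    have := FiniteField.even_card_of_char_two h
    rw [hF] at this
    obtain ⟨r, hr⟩ := hodd
    omega
  have hT := psl_hasTori h2
  have hC := psl_hasCycles h2
  refine ⟨fun a ha H hc hcard => part_one hT a ha H hc hcard, ?_⟩
  have hk3 : 3 ≤ k := by
    have hc := psl_card h2
    rw [hF] at hc
    have h16 : 16 ∣ q ^ 2 - 1 := by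
      have hdiv := Nat.div_add_mod q 8
      generalize q / 8 = s at hdiv
      rcases hmod with h | h
      · rw [h] at hdiv
        refine ⟨4 * s ^ 2 + s, ?_⟩
        rw [← hdiv]
        have : (8 * s + 1) ^ 2 = 16 * (4 * s ^ 2 + s) + 1 := by ring
        omega
      · rw [h] at hdiv
        refine ⟨4 * s ^ 2 + 7 * s + 3, ?_⟩
        rw [← hdiv]
        have : (8 * s + 7) ^ 2 = 16 * (4 * s ^ 2 + 7 * s + 3) + 1 := by ring
        omega
    have h8 : 2 ^ 3 ∣ Nat.card (Matrix.ProjectiveSpecialLinearGroup (Fin 2) F) := by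
      have : 16 ∣ 2 * Nat.card (Matrix.ProjectiveSpecialLinearGroup (Fin 2) F) := by
        rw [hc]; exact Dvd.dvd.mul_left h16 q
      omega
    rw [hk]
    exact (Nat.prime_two.pow_dvd_iff_le_factorization Nat.card_pos.ne').mp h8
  rintro H (⟨⟨e⟩⟩ | ⟨⟨e⟩⟩)
  · refine part_half hT hC k hk hk3 H ?_ ?_
    · rw [Nat.card_congr e.toEquiv, DihedralGroup.nat_card, ← pow_succ']
      congr 1; omega
    · intro h
      have hc : IsCyclic (DihedralGroup (2 ^ (k - 2))) := isCyclic_of_surjective e e.surjective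
      exact DihedralGroup.not_isCyclic (Nat.one_lt_two_pow (by omega)).ne' hc
  · refine part_sylow H ?_
    rw [Nat.card_congr e.toEquiv, DihedralGroup.nat_card, ← pow_succ', ← hk]
    congr 1; omega
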